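/- Given δ > 0 there exist τ < 1 and a constant C (both depending only on δ) such that the following holds for every prime p. Let F be the field with p² elements containing ℤ/pℤ, let σ ∈ ℤ/pℤ with σ ≠ 0 and σ ≠ 1, and let H₁, H₂ be subgroups of Fˣ, each of which is contained either in (ℤ/pℤ)ˣ or in the norm-one subgroup {h ∈ Fˣ : h^{p+1} = 1}. Assume |H₂| ≤ |H₁| and p^δ < |H₁| < p^{1−δ}. Then the number of pairs (h₁, h₂) ∈ H₁ × H₂ satisfying h₁ + σ·h₁⁻¹ = h₂ + h₂⁻¹ is at most C·|H₁|^τ. -/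

import Mathlib

section Helpers

open Polynomial Matrix

section Wronskian

variable {k R I : Type*} [CommRing k] [CommRing R] [Algebra k R]

/-- The Wronskian matrix of the functions `g i` selected by `J`, for the derivation `E`. -/
def wronskianMatrix (E : Derivation k R R) (g : I → R) {r : ℕ} (J : Fin r → I) :
    Matrix (Fin r) (Fin r) R :=
  Matrix.of fun s l => E^[s] (g (J l))

theorem wronskianMatrix_update (E : Derivation k R R) (g : I → R) {r : ℕ} (J : Fin r → I)
    (l : Fin r) (i : I) :
    wronskianMatrix E g (Function.update J l i) =
      (wronskianMatrix E g J).updateCol l (fun s => E^[s] (g i)) := by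
  ext s t
  by_cases h : t = l
  · subst h; simp [wronskianMatrix]
  · simp [wronskianMatrix, h]

theorem iterate_derivation_sum {ι : Type*} (E : Derivation k R R) (S : Finset ι) (f : ι → R)
    (s : ℕ) : E^[s] (∑ i ∈ S, f i) = ∑ i ∈ S, E^[s] (f i) := by
  induction s with
  | zero => rfl
  | succ s ih => simp only [Function.iterate_succ_apply', ih, map_sum]

theorem exists_maximal_wronskian [Finite I] (E : Derivation k R R) (g : I → R) (hg : ∃ i, g i ≠ 0) :
    ∃ (r : ℕ) (J : Fin r → I), 0 < r ∧ r ≤ Nat.card I ∧ (wronskianMatrix E g J).det ≠ 0 ∧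
      ∀ J' : Fin (r + 1) → I, (wronskianMatrix E g J').det = 0 := by
  classical
  set S : Set ℕ := {r | ∃ J : Fin r → I, (wronskianMatrix E g J).det ≠ 0}
  have hle : ∀ r ∈ S, r ≤ Nat.card I := by
    rintro r ⟨J, hJ⟩
    have hinj : Function.Injective J := by
      intro a b hab
      by_contra hne
      exact hJ (Matrix.det_zero_of_column_eq hne fun s => by simp [wronskianMatrix, hab])
    simpa using Nat.card_le_card_of_injective J hinj
  have h1 : 1 ∈ S := by
    obtain ⟨i, hi⟩ := hg
    exact ⟨fun _ => i, by simpa [wronskianMatrix] using hi⟩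
  have hbdd : BddAbove S := ⟨_, hle⟩
  have hmem : sSup S ∈ S := Nat.sSup_mem ⟨1, h1⟩ hbdd
  obtain ⟨J, hJ⟩ := hmem
  refine ⟨sSup S, J, le_csSup hbdd h1, hle _ ⟨J, hJ⟩, hJ, fun J' => ?_⟩
  by_contra h
  have : sSup S + 1 ≤ sSup S := le_csSup hbdd ⟨J', h⟩
  omega

variable [IsDomain R]

/-- If all Wronskians of size `r + 1` vanish, Cramer's rule holds for the row of index `r` too. -/
theorem sum_cramer_mul_iterate (E : Derivation k R R) (g : I → R) {r : ℕ} (J : Fin r → I)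
    (hJ : (wronskianMatrix E g J).det ≠ 0)
    (hmax : ∀ J' : Fin (r + 1) → I, (wronskianMatrix E g J').det = 0) (i : I) (s : ℕ)
    (hs : s ≤ r) :
    ∑ l, E^[s] (g (J l)) * (wronskianMatrix E g (Function.update J l i)).det =
      (wronskianMatrix E g J).det * E^[s] (g i) := by
  set G := wronskianMatrix E g J with hG
  set b : Fin r → R := fun s => E^[s] (g i) with hb
  have hcr : ∀ l, (wronskianMatrix E g (Function.update J l i)).det = G.cramer b l := by
    intro l
    rw [wronskianMatrix_update, Matrix.cramer_apply]
  simp_rw [hcr]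
  have hrow : ∀ t : Fin r, ∑ l, E^[t] (g (J l)) * G.cramer b l = G.det * E^[t] (g i) := by
    intro t
    have := congrFun (Matrix.mulVec_cramer G b) t
    simpa [Matrix.mulVec, dotProduct, hG, wronskianMatrix, hb] using this
  rcases lt_or_eq_of_le hs with hlt | rfl
  · exact hrow ⟨s, hlt⟩
  obtain ⟨v, hv0, hv⟩ := Matrix.exists_mulVec_eq_zero_iff.mpr
    (hmax (Fin.snoc (α := fun _ => I) J i))
  have hv' : ∀ t : ℕ, t < s + 1 →
      ∑ l : Fin s, E^[t] (g (J l)) * v l.castSucc + E^[t] (g i) * v (Fin.last s) = 0 := by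
    intro t ht
    have := congrFun hv ⟨t, ht⟩
    simpa [Matrix.mulVec, dotProduct, wronskianMatrix, Fin.sum_univ_castSucc] using this
  have key : G *ᵥ (fun l => G.det * v l.castSucc + v (Fin.last s) * G.cramer b l) = 0 := by
    ext t
    have h1 := hv' t (by omega)
    have h2 := hrow t
    simp only [Matrix.mulVec, dotProduct, Pi.zero_apply]
    have : ∀ l, G t l = E^[t] (g (J l)) := fun l => rfl
    simp only [this, mul_add, Finset.sum_add_distrib]
    have e1 : ∑ l, E^[t] (g (J l)) * (G.det * v l.castSucc) =
        G.det * ∑ l : Fin s, E^[t] (g (J l)) * v l.castSucc := by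
      rw [Finset.mul_sum]; exact Finset.sum_congr rfl fun _ _ => by ring
    have e2 : ∑ l, E^[t] (g (J l)) * (v (Fin.last s) * G.cramer b l) =
        v (Fin.last s) * ∑ l : Fin s, E^[t] (g (J l)) * G.cramer b l := by
      rw [Finset.mul_sum]; exact Finset.sum_congr rfl fun _ _ => by ring
    rw [e1, e2, h2]
    linear_combination G.det * h1
  have hz := Matrix.eq_zero_of_mulVec_eq_zero hJ key
  have hz' : ∀ l : Fin s, G.det * v l.castSucc = -(v (Fin.last s) * G.cramer b l) := fun l =>
    eq_neg_of_add_eq_zero_left (congrFun hz l)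
  have hlast : v (Fin.last s) ≠ 0 := by
    intro h0
    apply hv0
    ext l
    refine Fin.lastCases h0 (fun l => ?_) l
    have := hz' l
    rw [h0, zero_mul, neg_zero] at this
    exact (mul_eq_zero.mp this).resolve_left hJ
  apply mul_left_cancel₀ hlast
  have h1 := hv' s (by omega)
  have e1 : G.det * ∑ l : Fin s, E^[s] (g (J l)) * v l.castSucc =
      -(v (Fin.last s) * ∑ l, E^[s] (g (J l)) * G.cramer b l) := by
    rw [Finset.mul_sum, Finset.mul_sum, ← Finset.sum_neg_distrib]
    exact Finset.sum_congr rfl fun l _ => by linear_combination E^[s] (g (J l)) * hz' l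
  linear_combination e1 - G.det * h1

/-- A nontrivial relation `∑ i, g i = 0` produces two nonzero Wronskians, differing in one entry,
whose quotient is a constant of the derivation. -/
theorem exists_wronskian_ratio_constant [Fintype I] (E : Derivation k R R) (g : I → R)
    (hg : ∃ i, g i ≠ 0) (hsum : ∑ i, g i = 0) :
    ∃ (r : ℕ) (J : Fin r → I) (l : Fin r) (i : I), r ≤ Nat.card I ∧ i ≠ J l ∧
      (wronskianMatrix E g J).det ≠ 0 ∧ (wronskianMatrix E g (Function.update J l i)).det ≠ 0 ∧
      (wronskianMatrix E g J).det * E (wronskianMatrix E g (Function.update J l i)).det =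
        (wronskianMatrix E g (Function.update J l i)).det * E (wronskianMatrix E g J).det := by
  classical
  obtain ⟨r, J, hr0, hr, hJ, hmax⟩ := exists_maximal_wronskian E g hg
  set G := wronskianMatrix E g J with hG
  have hcr : ∀ l i, (wronskianMatrix E g (Function.update J l i)).det =
      G.cramer (fun s => E^[s] (g i)) l := by
    intro l i
    rw [wronskianMatrix_update, Matrix.cramer_apply]
  have hrel := fun i => sum_cramer_mul_iterate E g J hJ hmax i
  set a : I → Fin r → R := fun i l => (wronskianMatrix E g (Function.update J l i)).det with ha
  have hconst : ∀ i l, G.det * E (a i l) = a i l * E G.det := by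
    intro i
    have key : G *ᵥ (fun l => G.det * E (a i l) - a i l * E G.det) = 0 := by
      ext t
      have h1 := hrel i t t.2.le
      have h2 := hrel i (t + 1) t.2
      have h3 := congrArg E h1
      simp only [map_sum, Derivation.leibniz, smul_eq_mul, ← Function.iterate_succ_apply' E,
        Finset.sum_add_distrib] at h3
      have e0 : ∑ l, a i l * E^[t + 1] (g (J l)) = ∑ l, E^[t + 1] (g (J l)) * a i l :=
        Finset.sum_congr rfl fun _ _ => mul_comm _ _
      simp only [Matrix.mulVec, dotProduct, Pi.zero_apply]
      have : ∀ l, G t l = E^[t] (g (J l)) := fun l => rfl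
      simp only [this, mul_sub, Finset.sum_sub_distrib]
      have e1 : ∑ l, E^[t] (g (J l)) * (G.det * E (a i l)) =
          G.det * ∑ l, E^[t] (g (J l)) * E (a i l) := by
        rw [Finset.mul_sum]; exact Finset.sum_congr rfl fun _ _ => by ring
      have e2 : ∑ l, E^[t] (g (J l)) * (a i l * E G.det) =
          E G.det * ∑ l, E^[t] (g (J l)) * a i l := by
        rw [Finset.mul_sum]; exact Finset.sum_congr rfl fun _ _ => by ring
      rw [e1, e2]
      simp only [ha] at *
      rw [e0] at h3
      linear_combination G.det * h3 - G.det * h2 - E G.det * h1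
    intro l
    exact sub_eq_zero.mp (congrFun (Matrix.eq_zero_of_mulVec_eq_zero hJ key) l)
  let l : Fin r := ⟨0, hr0⟩
  have htot : ∑ i, a i l = 0 := by
    simp only [ha, hcr]
    rw [← Finset.sum_apply, ← map_sum]
    have : ∑ i, (fun s : Fin r => E^[(s : ℕ)] (g i)) = 0 := by
      ext s
      rw [Finset.sum_apply, ← iterate_derivation_sum, hsum, iterate_map_zero, Pi.zero_apply]
    rw [this, map_zero, Pi.zero_apply]
  have hself : a (J l) l = G.det := by simp [ha, hG]
  have hex : ∃ i, i ≠ J l ∧ a i l ≠ 0 := by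
    by_contra! h
    rw [Finset.sum_eq_single (J l) (fun i _ hi => h i hi) (by simp), hself] at htot
    exact hJ htot
  obtain ⟨i, hi, hai⟩ := hex
  exact ⟨r, J, l, i, hr, hi, hJ, hai, hconst i l⟩

end Wronskian

section Vanishing

variable {k R L : Type*} [CommRing k] [CommRing R] [Algebra k R] [Field L]

/-- `r` vanishes to order at least `M` at the point `ev`, as measured by the derivation `E`. -/
def VanishesTo (E : Derivation k R R) (ev : R →+* L) (M : ℕ) (r : R) : Prop :=
  ∀ s < M, ev (E^[s] r) = 0

variable {E : Derivation k R R} {ev : R →+* L}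

theorem vanishesTo_succ_iff {M : ℕ} {r : R} :
    VanishesTo E ev (M + 1) r ↔ ev r = 0 ∧ VanishesTo E ev M (E r) := by
  constructor
  · intro h
    exact ⟨h 0 (by omega), fun s hs => by simpa using h (s + 1) (by omega)⟩
  · rintro ⟨h0, h⟩ s hs
    cases s with
    | zero => simpa using h0
    | succ s => simpa using h s (by omega)

theorem VanishesTo.mono {M M' : ℕ} {r : R} (h : VanishesTo E ev M r) (hM : M' ≤ M) :
    VanishesTo E ev M' r := fun s hs => h s (by omega)

theorem VanishesTo.add {M : ℕ} {r r' : R} (h : VanishesTo E ev M r) (h' : VanishesTo E ev M r') :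
    VanishesTo E ev M (r + r') := by
  intro s hs
  rw [iterate_map_add, map_add, h s hs, h' s hs, add_zero]

theorem VanishesTo.sub {M : ℕ} {r r' : R} (h : VanishesTo E ev M r) (h' : VanishesTo E ev M r') :
    VanishesTo E ev M (r - r') := by
  intro s hs
  rw [iterate_map_sub, map_sub, h s hs, h' s hs, sub_zero]

theorem VanishesTo.mul_left {M : ℕ} {r : R} (h : VanishesTo E ev M r) (t : R) :
    VanishesTo E ev M (t * r) := by
  induction M generalizing r t with
  | zero => intro s hs; omega
  | succ M ih =>
    have h' := vanishesTo_succ_iff.mp h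
    refine vanishesTo_succ_iff.mpr ⟨by rw [map_mul, h'.1, mul_zero], ?_⟩
    rw [Derivation.leibniz, smul_eq_mul, smul_eq_mul, mul_comm r]
    exact (ih h'.2 t).add (ih (h.mono (by omega)) _)

theorem VanishesTo.of_mul_left {M : ℕ} {t r : R} (ht : ev t ≠ 0) (h : VanishesTo E ev M (t * r)) :
    VanishesTo E ev M r := by
  induction M generalizing r with
  | zero => intro s hs; omega
  | succ M ih =>
    have h' := vanishesTo_succ_iff.mp h
    have hr : VanishesTo E ev M r := ih (h.mono (by omega))
    refine vanishesTo_succ_iff.mpr ⟨?_, ih ?_⟩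
    · have := h'.1
      rw [map_mul] at this
      exact (mul_eq_zero.mp this).resolve_left ht
    · have h2 := h'.2
      rw [Derivation.leibniz, smul_eq_mul, smul_eq_mul] at h2
      simpa [mul_comm] using h2.sub (hr.mul_left (E t))

/-- A function that vanishes at a point and is an eigenfunction of the derivation near it vanishes
there to every order. -/
theorem vanishesTo_of_mul_deriv_eq {t e c : R} (ht : ev t ≠ 0) (he : ev e = 0)
    (h : t * E e = c * e) (M : ℕ) : VanishesTo E ev M e := by
  induction M with
  | zero => intro s hs; omega
  | succ M ih =>
    refine vanishesTo_succ_iff.mpr ⟨he, VanishesTo.of_mul_left ht ?_⟩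
    rw [h]
    exact ih.mul_left c

theorem eval_iterate_pow_mul {u : R} (hu : ev u = 0) (M : ℕ) (h : R) :
    ev (E^[M] (u ^ M * h)) = M.factorial * ev (E u) ^ M * ev h := by
  induction M generalizing h with
  | zero => simp
  | succ M ih =>
    have : E (u ^ (M + 1) * h) = u ^ M * (((M + 1 : ℕ) : R) * E u * h + u * E h) := by
      simp only [Derivation.leibniz, Derivation.leibniz_pow, smul_eq_mul, nsmul_eq_mul,
        Nat.add_sub_cancel]
      ring
    rw [Function.iterate_succ_apply, this, ih]
    simp only [map_add, map_mul, hu, map_natCast, Nat.factorial_succ]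
    push_cast
    ring

end Vanishing

section Curve

variable {K : Type*} [Field K]

/-- The coordinate ring `K[x, z]` of the curve `z ^ 2 = (x ^ 2 + σ) z - x ^ 2`, which is the curve
`x + σ / x = y + 1 / y` in the coordinates `x` and `z = x y`. -/
abbrev MarkoffRing (σ : K) : Type _ := QuadraticAlgebra K[X] (-X ^ 2) (X ^ 2 + C σ)

namespace MarkoffRing

variable {σ : K}

/-- The coordinate function `x`. -/
noncomputable def x : MarkoffRing σ := ⟨X, 0⟩

/-- The coordinate function `z = x y`. -/
noncomputable def z : MarkoffRing σ := ⟨0, 1⟩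

theorem x_ne_zero : (x : MarkoffRing σ) ≠ 0 := fun h =>
  X_ne_zero (congrArg QuadraticAlgebra.re h)

theorem z_ne_zero : (z : MarkoffRing σ) ≠ 0 := fun h =>
  one_ne_zero (congrArg QuadraticAlgebra.im h)

/-- The function `x ^ 2 + σ`, the trace of `z` over `K[x]`. -/
noncomputable def s : MarkoffRing σ := ⟨X ^ 2 + C σ, 0⟩

/-- The derivation of the coordinate ring tangent to the curve and proportional to
`x (y - 1 / y) ∂/∂x + y (x - σ / x) ∂/∂y`. -/
noncomputable def E (σ : K) : Derivation K (MarkoffRing σ) (MarkoffRing σ) :=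
  Derivation.mk'
    { toFun := fun u =>
        ⟨-(X * (X ^ 2 + C σ) * derivative u.re) - 2 * X ^ 3 * derivative u.im - 2 * X ^ 2 * u.im,
          2 * X * derivative u.re + X * (X ^ 2 + C σ) * derivative u.im + 2 * X ^ 2 * u.im⟩
      map_add' := fun u v => by
        ext1 <;> simp <;> ring
      map_smul' := fun c u => by
        ext1 <;> simp [smul_eq_C_mul] <;> ring }
    (fun u v => by
      ext1 <;> simp [derivative_mul] <;> ring)

theorem E_apply (u : MarkoffRing σ) : E σ u =
    ⟨-(X * (X ^ 2 + C σ) * derivative u.re) - 2 * X ^ 3 * derivative u.im - 2 * X ^ 2 * u.im,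
      2 * X * derivative u.re + X * (X ^ 2 + C σ) * derivative u.im + 2 * X ^ 2 * u.im⟩ := rfl

theorem E_x : E σ x = x * (2 * z - s) := by
  rw [E_apply]
  ext1 <;> simp [x, z, s, QuadraticAlgebra.re_ofNat, QuadraticAlgebra.im_ofNat] <;> ring

theorem E_z : E σ z = z * (2 * (z - algebraMap K _ σ)) := by
  rw [E_apply]
  ext1 <;> simp [z, QuadraticAlgebra.re_ofNat, QuadraticAlgebra.im_ofNat,
    IsScalarTower.algebraMap_apply K K[X] (MarkoffRing σ)] <;> ring

/-- The logarithmic derivative of `x ^ i * z ^ j`. -/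
noncomputable def logDeriv (σ : K) (i j : ℕ) : MarkoffRing σ :=
  (i : K) • (2 * z - s) + (j : K) • (2 * (z - algebraMap K _ σ))

theorem E_monomial (i j : ℕ) :
    E σ (x ^ i * z ^ j) = logDeriv σ i j * (x ^ i * z ^ j) := by
  have hp : ∀ (t c : MarkoffRing σ) (i : ℕ), E σ t = t * c →
      E σ (t ^ i) = t ^ i * ((i : K) • c) := by
    intro t c i h
    induction i with
    | zero => simp
    | succ i ih =>
      rw [pow_succ t i, Derivation.leibniz, ih, h]
      simp only [smul_eq_mul, Nat.cast_succ, Algebra.smul_def, map_add, map_one]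
      ring
  rw [Derivation.leibniz, hp _ _ _ E_x, hp _ _ _ E_z, logDeriv]
  simp only [smul_eq_mul]
  ring

/-- Evaluation at a point of the curve. -/
noncomputable def evalAt (x₀ z₀ : K) (h : z₀ ^ 2 = (x₀ ^ 2 + σ) * z₀ - x₀ ^ 2) :
    MarkoffRing σ →+* K where
  toFun u := u.re.eval x₀ + u.im.eval x₀ * z₀
  map_one' := by simp [QuadraticAlgebra.re_one, QuadraticAlgebra.im_one]
  map_zero' := by simp
  map_add' u v := by simp; ring
  map_mul' u v := by
    simp
    linear_combination (u.im.eval x₀ * v.im.eval x₀) * (-h)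

section Eval

variable {x₀ z₀ : K} {h : z₀ ^ 2 = (x₀ ^ 2 + σ) * z₀ - x₀ ^ 2}

theorem evalAt_x : evalAt x₀ z₀ h x = x₀ := by simp [evalAt, x]

theorem evalAt_z : evalAt x₀ z₀ h z = z₀ := by simp [evalAt, z]

theorem evalAt_s : evalAt x₀ z₀ h s = x₀ ^ 2 + σ := by simp [evalAt, s]

theorem evalAt_algebraMap (f : K[X]) : evalAt x₀ z₀ h (algebraMap K[X] _ f) = f.eval x₀ := by
  simp [evalAt]

theorem evalAt_scalar (c : K) : evalAt x₀ z₀ h (algebraMap K _ c) = c := by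
  rw [IsScalarTower.algebraMap_apply K K[X] (MarkoffRing σ), evalAt_algebraMap]; simp

/-- Order of vanishing at a point of the curve bounds from below that of the norm to `K[x]`. -/
theorem pow_dvd_norm {p : ℕ} [CharP K p] (hx : x₀ ≠ 0) (hw : 2 * z₀ - (x₀ ^ 2 + σ) ≠ 0) {M : ℕ}
    (hp : p.Prime) (hM : M ≤ p) {u : MarkoffRing σ} (hu : VanishesTo (E σ) (evalAt x₀ z₀ h) M u) :
    (X - C x₀) ^ M ∣ QuadraticAlgebra.norm u := by
  by_cases h0 : QuadraticAlgebra.norm u = 0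
  · simp [h0]
  obtain ⟨q, hq, hndvd⟩ := exists_eq_pow_rootMultiplicity_mul_and_not_dvd _ h0 x₀
  set k := rootMultiplicity x₀ (QuadraticAlgebra.norm u)
  rcases le_or_gt M k with hk | hk
  · exact (pow_dvd_pow _ hk).trans ⟨q, hq⟩
  exfalso
  have hN : VanishesTo (E σ) (evalAt x₀ z₀ h) M (algebraMap K[X] _ (QuadraticAlgebra.norm u)) := by
    rw [QuadraticAlgebra.algebraMap_norm_eq_mul_star, mul_comm]
    exact hu.mul_left _
  have hE := hN k hk
  rw [hq, map_mul, map_pow, eval_iterate_pow_mul (by rw [evalAt_algebraMap]; simp),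
    evalAt_algebraMap] at hE
  have hEπ : E σ (algebraMap K[X] _ (X - C x₀)) = x * (2 * z - s) := by
    rw [← E_x, E_apply, E_apply]
    simp [x]
  rw [hEπ] at hE
  simp only [map_mul, map_sub, evalAt_x, evalAt_z, evalAt_s, map_ofNat] at hE
  have hq0 : q.eval x₀ ≠ 0 := fun h => hndvd (dvd_iff_isRoot.mpr h)
  have hf : (k.factorial : K) ≠ 0 := by
    rw [Ne, CharP.cast_eq_zero_iff K p, hp.dvd_factorial]
    omega
  exact mul_ne_zero (mul_ne_zero hf (pow_ne_zero _ (mul_ne_zero hx hw))) hq0 hE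

end Eval

/-- `u` has degree at most `d`, where `x` has degree `1` and `z` has degree `2`. -/
def DegLE (d : ℕ) (u : MarkoffRing σ) : Prop :=
  u.re.natDegree ≤ d ∧ (X ^ 2 * u.im).natDegree ≤ d

theorem natDegree_le_X_sq_mul (f : K[X]) : f.natDegree ≤ (X ^ 2 * f).natDegree := by
  by_cases h : f = 0
  · simp [h]
  · rw [natDegree_X_pow_mul 2 h]; omega

theorem natDegree_trace_mul_le (σ : K) (f : K[X]) :
    ((X ^ 2 + C σ) * f).natDegree ≤ (X ^ 2 * f).natDegree := by
  by_cases h : f = 0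
  · simp [h]
  · rw [natDegree_X_pow_mul 2 h]
    refine natDegree_mul_le.trans ?_
    rw [natDegree_X_pow_add_C]; omega

namespace DegLE

variable {d e : ℕ} {u v : MarkoffRing σ}

theorem mono (hu : DegLE d u) (h : d ≤ e) : DegLE e u := ⟨hu.1.trans h, hu.2.trans h⟩

theorem zero : DegLE d (0 : MarkoffRing σ) := by simp [DegLE]

theorem algebraMap (c : K) : DegLE d (algebraMap K (MarkoffRing σ) c) := by
  simp [DegLE, IsScalarTower.algebraMap_apply K K[X] (MarkoffRing σ)]

theorem add (hu : DegLE d u) (hv : DegLE d v) : DegLE d (u + v) := by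
  refine ⟨natDegree_add_le_of_degree_le hu.1 hv.1, ?_⟩
  rw [QuadraticAlgebra.im_add, mul_add]
  exact natDegree_add_le_of_degree_le hu.2 hv.2

theorem mul (hu : DegLE d u) (hv : DegLE e v) : DegLE (d + e) (u * v) := by
  constructor
  · rw [QuadraticAlgebra.re_mul]
    refine natDegree_add_le_of_degree_le (natDegree_mul_le_of_le hu.1 hv.1) ?_
    rw [show -X ^ 2 * u.im * v.im = -((X ^ 2 * u.im) * v.im) by ring, natDegree_neg]
    exact natDegree_mul_le_of_le hu.2 ((natDegree_le_X_sq_mul _).trans hv.2)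
  · rw [QuadraticAlgebra.im_mul, show X ^ 2 * (u.re * v.im + u.im * v.re +
      (X ^ 2 + C σ) * u.im * v.im) = u.re * (X ^ 2 * v.im) + (X ^ 2 * u.im) * v.re +
      ((X ^ 2 + C σ) * u.im) * (X ^ 2 * v.im) by ring]
    refine natDegree_add_le_of_degree_le (natDegree_add_le_of_degree_le ?_ ?_) ?_
    · exact natDegree_mul_le_of_le hu.1 hv.2
    · exact natDegree_mul_le_of_le hu.2 hv.1
    · exact natDegree_mul_le_of_le ((natDegree_trace_mul_le _ _).trans hu.2) hv.2

theorem smul (c : K) (hu : DegLE d u) : DegLE d (c • u) := by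
  rw [Algebra.smul_def]
  simpa using (algebraMap (d := 0) c).mul hu

theorem neg (hu : DegLE d u) : DegLE d (-u) := by simpa using hu.smul (-1)

theorem sub (hu : DegLE d u) (hv : DegLE d v) : DegLE d (u - v) := by
  rw [sub_eq_add_neg]; exact hu.add hv.neg

theorem sum {ι : Type*} (S : Finset ι) {f : ι → MarkoffRing σ} (h : ∀ i ∈ S, DegLE d (f i)) :
    DegLE d (∑ i ∈ S, f i) :=
  Finset.sum_induction f (DegLE d) (fun _ _ => add) zero h

theorem prod {ι : Type*} (S : Finset ι) {f : ι → MarkoffRing σ} (h : ∀ i ∈ S, DegLE d (f i)) :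
    DegLE (S.card * d) (∏ i ∈ S, f i) := by
  classical
  induction S using Finset.induction_on with
  | empty => simpa using algebraMap (σ := σ) (d := 0) 1
  | insert a S ha ih =>
    rw [Finset.prod_insert ha, Finset.card_insert_of_notMem ha, add_mul, one_mul, add_comm]
    exact (h a (by simp)).mul (ih fun i hi => h i (by simp [hi]))

theorem pow (hu : DegLE d u) (i : ℕ) : DegLE (i * d) (u ^ i) := by
  simpa using prod (Finset.range i) (f := fun _ => u) fun _ _ => hu

theorem x : DegLE 1 (x : MarkoffRing σ) := by simp [DegLE, MarkoffRing.x]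

theorem z : DegLE 2 (z : MarkoffRing σ) := by simp [DegLE, MarkoffRing.z]

theorem s : DegLE 2 (s : MarkoffRing σ) := by simp [DegLE, MarkoffRing.s]

theorem monomial (i j : ℕ) :
    DegLE (i + 2 * j) (MarkoffRing.x ^ i * MarkoffRing.z ^ j : MarkoffRing σ) := by
  simpa [mul_comm] using (x.pow i).mul (z.pow j)

theorem logDeriv (i j : ℕ) : DegLE 2 (logDeriv σ i j) := by
  have h2 : ∀ {w : MarkoffRing σ}, DegLE 2 w → DegLE 2 (2 * w) := fun hw => by
    rw [two_mul]; exact hw.add hw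
  exact (((h2 z).sub s).smul _).add ((h2 (z.sub (algebraMap _))).smul _)

theorem deriv (hu : DegLE d u) : DegLE (d + 2) (E σ u) := by
  have hX : ∀ f : K[X], (X * derivative f).natDegree ≤ f.natDegree := by
    intro f
    by_cases h : f.natDegree = 0
    · rw [natDegree_eq_zero] at h
      obtain ⟨c, rfl⟩ := h
      simp
    · refine natDegree_mul_le.trans ?_
      have := natDegree_derivative_lt h
      rw [natDegree_X]; omega
  have hX2 : ∀ f : K[X], (X ^ 2 * (X * derivative f)).natDegree ≤ (X ^ 2 * f).natDegree := by
    intro f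
    by_cases h : f = 0
    · simp [h]
    by_cases h' : X * derivative f = 0
    · simp [h']
    rw [natDegree_X_pow_mul 2 h, natDegree_X_pow_mul 2 h']
    have := hX f
    omega
  have hs : (X ^ 2 + C σ : K[X]).natDegree ≤ 2 := by rw [natDegree_X_pow_add_C]
  have h2 : (2 : K[X]).natDegree ≤ 0 := by simp
  rw [E_apply]
  constructor
  · refine (natDegree_sub_le _ _).trans (max_le ((natDegree_sub_le _ _).trans (max_le ?_ ?_)) ?_)
    · rw [natDegree_neg, show X * (X ^ 2 + C σ) * derivative u.re =
        (X * derivative u.re) * (X ^ 2 + C σ) by ring]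
      exact natDegree_mul_le_of_le ((hX _).trans hu.1) hs
    · rw [show 2 * X ^ 3 * derivative u.im = 2 * (X ^ 2 * (X * derivative u.im)) by ring]
      exact (natDegree_mul_le_of_le h2 ((hX2 _).trans hu.2)).trans (by omega)
    · rw [mul_assoc]
      exact (natDegree_mul_le_of_le h2 hu.2).trans (by omega)
  · have hX2' : (X ^ 2 : K[X]).natDegree ≤ 2 := natDegree_X_pow_le 2
    rw [mul_add, mul_add]
    refine natDegree_add_le_of_degree_le (natDegree_add_le_of_degree_le ?_ ?_) ?_
    · rw [show X ^ 2 * (2 * X * derivative u.re) = 2 * ((X * derivative u.re) * X ^ 2) by ring]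
      exact (natDegree_mul_le_of_le h2 (natDegree_mul_le_of_le ((hX _).trans hu.1) hX2')).trans
        (by omega)
    · rw [show X ^ 2 * (X * (X ^ 2 + C σ) * derivative u.im) =
        (X ^ 2 * (X * derivative u.im)) * (X ^ 2 + C σ) by ring]
      exact natDegree_mul_le_of_le ((hX2 _).trans hu.2) hs
    · rw [show X ^ 2 * (2 * X ^ 2 * u.im) = 2 * ((X ^ 2 * u.im) * X ^ 2) by ring]
      exact (natDegree_mul_le_of_le h2 (natDegree_mul_le_of_le hu.2 hX2')).trans (by omega)

theorem norm (hu : DegLE d u) : (QuadraticAlgebra.norm u).natDegree ≤ 2 * d := by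
  rw [QuadraticAlgebra.norm_def, two_mul]
  refine (natDegree_sub_le _ _).trans (max_le (natDegree_add_le_of_degree_le ?_ ?_) ?_)
  · exact natDegree_mul_le_of_le hu.1 hu.1
  · rw [show (X ^ 2 + C σ) * u.re * u.im = u.re * ((X ^ 2 + C σ) * u.im) by ring]
    exact natDegree_mul_le_of_le hu.1 ((natDegree_trace_mul_le _ _).trans hu.2)
  · rw [show -X ^ 2 * u.im * u.im = -((X ^ 2 * u.im) * u.im) by ring, natDegree_neg]
    exact natDegree_mul_le_of_le hu.2 ((natDegree_le_X_sq_mul _).trans hu.2)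

theorem det {r : ℕ} {A : Matrix (Fin r) (Fin r) (MarkoffRing σ)} (h : ∀ i j, DegLE d (A i j)) :
    DegLE (r * d) A.det := by
  rw [Matrix.det_apply]
  refine sum _ fun τ _ => ?_
  have hp : DegLE (r * d) (∏ i, A (τ i) i) := by
    simpa using prod Finset.univ (f := fun i => A (τ i) i) fun i _ => h _ _
  rcases Int.units_eq_one_or (Equiv.Perm.sign τ) with h1 | h1
  · simpa [h1] using hp
  · simpa [h1] using hp.neg

end DegLE

end MarkoffRing

end Curve

namespace MarkoffRing

variable {K : Type*} [Field K] {σ : K}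

section Domain

variable [IsAlgClosed K]

/-- The discriminant of the curve over `K[x]` is not a square up to squares. -/
theorem sq_ne_discr_mul_sq (h2 : (2 : K) ≠ 0) (hσ0 : σ ≠ 0) (hσ1 : σ ≠ 1) {f g : K[X]}
    (hg : g ≠ 0) : f ^ 2 ≠ ((X ^ 2 + C σ) ^ 2 - 4 * X ^ 2) * g ^ 2 := by
  intro h
  obtain ⟨w, hw⟩ := IsAlgClosed.exists_pow_nat_eq (1 - σ) (n := 2) (by norm_num)
  have hw0 : w ≠ 0 := by
    rintro rfl
    apply hσ1
    linear_combination hw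
  set α := 1 + w with hα
  have hα2 : α ^ 2 - 2 * α + σ = 0 := by rw [hα]; linear_combination hw
  have hα0 : α ≠ 0 := by
    intro h0
    apply hσ0
    rw [h0] at hα2
    linear_combination hα2
  set q : K[X] := (X - C (2 - α)) * (X ^ 2 + 2 * X + C σ) with hq
  have hfac : (X ^ 2 + C σ) ^ 2 - 4 * X ^ 2 = (X - C α) * q := by
    have : C σ = C α * C (2 - α) := by
      rw [← C_mul]; congr 1; linear_combination hα2
    rw [hq, this]
    simp only [C_sub, map_ofNat]
    ring
  have hqα : q.eval α ≠ 0 := by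
    simp only [hq, eval_mul, eval_sub, eval_X, eval_C, eval_add, eval_pow, eval_ofNat]
    have e1 : α - (2 - α) = 2 * w := by rw [hα]; ring
    have e2 : α ^ 2 + 2 * α + σ = 2 * 2 * α := by linear_combination hα2
    rw [e1, e2]
    exact mul_ne_zero (mul_ne_zero h2 hw0) (mul_ne_zero (mul_ne_zero h2 h2) hα0)
  have hq0 : q ≠ 0 := by rintro h0; simp [h0] at hqα
  have hl : (X - C α) ≠ 0 := X_sub_C_ne_zero α
  have hf : f ≠ 0 := by
    rintro rfl
    rw [hfac] at h
    have := mul_ne_zero (mul_ne_zero hl hq0) (pow_ne_zero 2 hg)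
    apply this
    rw [← h]; ring
  have hr := congrArg (rootMultiplicity α) h
  have hsq : ∀ {t : K[X]}, t ≠ 0 → rootMultiplicity α (t ^ 2) = 2 * rootMultiplicity α t := by
    intro t ht
    rw [sq, rootMultiplicity_mul (mul_ne_zero ht ht), two_mul]
  rw [hfac, rootMultiplicity_mul (mul_ne_zero (mul_ne_zero hl hq0) (pow_ne_zero 2 hg)),
    rootMultiplicity_mul (mul_ne_zero hl hq0), hsq hf, hsq hg, rootMultiplicity_X_sub_C_self,
    rootMultiplicity_eq_zero hqα] at hr
  omega

theorem discr_ne_zero (h2 : (2 : K) ≠ 0) (hσ0 : σ ≠ 0) (hσ1 : σ ≠ 1) :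
    (X ^ 2 + C σ) ^ 2 - 4 * X ^ 2 ≠ (0 : K[X]) := fun h =>
  sq_ne_discr_mul_sq h2 hσ0 hσ1 (one_ne_zero (α := K[X])) (f := 0) (by rw [h]; ring)

theorem eq_zero_of_norm_eq_zero (h2 : (2 : K) ≠ 0) (hσ0 : σ ≠ 0) (hσ1 : σ ≠ 1) {u : MarkoffRing σ}
    (h : QuadraticAlgebra.norm u = 0) : u = 0 := by
  rw [QuadraticAlgebra.norm_def] at h
  have hsq : (2 * u.re + (X ^ 2 + C σ) * u.im) ^ 2 =
      ((X ^ 2 + C σ) ^ 2 - 4 * X ^ 2) * u.im ^ 2 := by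
    linear_combination 4 * h
  have him : u.im = 0 := by
    by_contra hne
    exact sq_ne_discr_mul_sq h2 hσ0 hσ1 hne hsq
  have hre : u.re = 0 := by
    rw [him] at h
    simpa using h
  ext1
  · exact hre
  · exact him

theorem isDomain (h2 : (2 : K) ≠ 0) (hσ0 : σ ≠ 0) (hσ1 : σ ≠ 1) : IsDomain (MarkoffRing σ) := by
  have : NoZeroDivisors (MarkoffRing σ) := ⟨fun {a b} hab => by
    have := congrArg QuadraticAlgebra.norm hab
    rw [map_mul, QuadraticAlgebra.norm_zero, mul_eq_zero] at this
    exact this.imp (eq_zero_of_norm_eq_zero h2 hσ0 hσ1) (eq_zero_of_norm_eq_zero h2 hσ0 hσ1)⟩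
  exact NoZeroDivisors.to_isDomain _

/-- Two functions of small degree whose quotient is killed by the derivation are proportional. -/
theorem eq_smul_of_deriv_ratio_eq_zero {p : ℕ} [CharP K p] (hp : p.Prime) (h2 : (2 : K) ≠ 0)
    (hσ0 : σ ≠ 0) (hσ1 : σ ≠ 1) {a b : MarkoffRing σ} {d : ℕ} (ha : DegLE d a) (hb : DegLE d b)
    (hd : 2 * d < p) (hb0 : b ≠ 0) (hab : b * E σ a = a * E σ b) : ∃ c : K, a = c • b := by
  have hN : QuadraticAlgebra.norm b ≠ 0 := fun h => hb0 (eq_zero_of_norm_eq_zero h2 hσ0 hσ1 h)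
  have hprod : QuadraticAlgebra.norm b * X * ((X ^ 2 + C σ) ^ 2 - 4 * X ^ 2) ≠ 0 :=
    mul_ne_zero (mul_ne_zero hN X_ne_zero) (discr_ne_zero h2 hσ0 hσ1)
  obtain ⟨x₀, hx₀⟩ : ∃ x₀, eval x₀ (QuadraticAlgebra.norm b * X *
      ((X ^ 2 + C σ) ^ 2 - 4 * X ^ 2)) ≠ 0 := by
    by_contra! h
    exact hprod (Polynomial.funext fun r => by rw [h r, eval_zero])
  simp only [eval_mul, eval_X, eval_sub, eval_pow, eval_add, eval_C, eval_ofNat, ne_eq,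
    mul_eq_zero, not_or] at hx₀
  obtain ⟨⟨hNx, hx⟩, hΔx⟩ := hx₀
  obtain ⟨w, hw⟩ := IsAlgClosed.exists_pow_nat_eq ((x₀ ^ 2 + σ) ^ 2 - 4 * x₀ ^ 2) (n := 2)
    (by norm_num)
  set z₀ := (x₀ ^ 2 + σ + w) / 2 with hz₀
  have hwz : 2 * z₀ - (x₀ ^ 2 + σ) = w := by rw [hz₀]; field_simp; ring
  have hcurve : z₀ ^ 2 = (x₀ ^ 2 + σ) * z₀ - x₀ ^ 2 := by
    rw [← hwz] at hw
    have : (2 * 2 : K) * (z₀ ^ 2 - ((x₀ ^ 2 + σ) * z₀ - x₀ ^ 2)) = 0 := by linear_combination hw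
    exact sub_eq_zero.mp ((mul_eq_zero.mp this).resolve_left (mul_ne_zero h2 h2))
  have hw0 : 2 * z₀ - (x₀ ^ 2 + σ) ≠ 0 := by
    rw [hwz]
    rintro rfl
    apply hΔx
    rw [← hw]; ring
  have hev : evalAt x₀ z₀ hcurve b ≠ 0 := by
    intro h0
    apply hNx
    rw [← evalAt_algebraMap (h := hcurve), QuadraticAlgebra.algebraMap_norm_eq_mul_star, map_mul,
      h0, zero_mul]
  set c := evalAt x₀ z₀ hcurve a / evalAt x₀ z₀ hcurve b with hc
  refine ⟨c, sub_eq_zero.mp ?_⟩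
  have hvan : VanishesTo (E σ) (evalAt x₀ z₀ hcurve) p (a - c • b) := by
    refine vanishesTo_of_mul_deriv_eq hev ?_ (c := E σ b) ?_ p
    · rw [map_sub, Algebra.smul_def, map_mul, evalAt_scalar, hc]
      field_simp
      ring
    · rw [map_sub, Derivation.map_smul, mul_sub, hab, Algebra.smul_def, Algebra.smul_def]
      ring
  have hdvd := pow_dvd_norm hx hw0 hp le_rfl hvan
  have hdeg := (ha.sub (hb.smul c)).norm
  refine eq_zero_of_norm_eq_zero h2 hσ0 hσ1 (eq_zero_of_dvd_of_natDegree_lt hdvd ?_)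
  rw [natDegree_pow, natDegree_X_sub_C]
  omega

end Domain

theorem norm_x : QuadraticAlgebra.norm (x : MarkoffRing σ) = X ^ 2 := by
  simp [QuadraticAlgebra.norm_def, x]; ring

theorem norm_z : QuadraticAlgebra.norm (z : MarkoffRing σ) = X ^ 2 := by
  simp [QuadraticAlgebra.norm_def, z]

theorem star_z_mul_z : star (z : MarkoffRing σ) * z = x ^ 2 := by
  rw [mul_comm, ← QuadraticAlgebra.algebraMap_norm_eq_mul_star, norm_z, map_pow]
  rfl

theorem isCoprime_z_star (hσ0 : σ ≠ 0) : IsCoprime (z : MarkoffRing σ) (star z) := by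
  refine ⟨σ⁻¹ • (1 - star z), σ⁻¹ • 1, ?_⟩
  have h : (1 - star z) * z + star z = algebraMap K (MarkoffRing σ) σ := by
    rw [sub_mul, star_z_mul_z, IsScalarTower.algebraMap_apply K K[X] (MarkoffRing σ)]
    ext1 <;> simp [x, z, sq]
  rw [smul_mul_assoc, smul_mul_assoc, ← smul_add, one_mul, h, Algebra.smul_def, ← map_mul,
    inv_mul_cancel₀ hσ0, map_one]

/-- The function `x ^ (m B) * x ^ (n c) * y ^ (m d)`, which is regular on the curve if `d ≤ B`. -/
noncomputable def block (σ : K) (n m B : ℕ) (i : Fin B × Fin B) : MarkoffRing σ :=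
  x ^ (n * i.1 + m * (B - i.2)) * z ^ (m * i.2)

theorem norm_block (n m B : ℕ) (i : Fin B × Fin B) :
    QuadraticAlgebra.norm (block σ n m B i) = X ^ (2 * (n * i.1 + m * B)) := by
  rw [block, map_mul, map_pow, map_pow, norm_x, norm_z, ← pow_mul, ← pow_mul, ← pow_add]
  congr 1
  rw [← mul_add, add_assoc, ← mul_add, Nat.sub_add_cancel i.2.2.le]

theorem block_ne_zero (n m B : ℕ) (i : Fin B × Fin B) : block σ n m B i ≠ 0 := by
  intro h
  have := norm_block (σ := σ) n m B i
  rw [h, QuadraticAlgebra.norm_zero] at this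
  exact pow_ne_zero _ X_ne_zero this.symm

theorem degLE_block (n m B : ℕ) (i : Fin B × Fin B) :
    DegLE ((n + 2 * m) * B) (block σ n m B i) := by
  refine (DegLE.monomial _ _).mono ?_
  obtain ⟨⟨c, hc⟩, ⟨d, hd⟩⟩ := i
  obtain ⟨k, rfl⟩ := Nat.exists_eq_add_of_le hd.le
  simp only [Nat.add_sub_cancel_left]
  nlinarith [Nat.mul_le_mul_left n hc.le]

variable [IsAlgClosed K]

theorem le_of_z_pow_mul_eq (h2 : (2 : K) ≠ 0) (hσ0 : σ ≠ 0) (hσ1 : σ ≠ 1) {a b : MarkoffRing σ}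
    {e t : ℕ} {c : K} (hb : DegLE e b) (hb0 : b ≠ 0) (hc : c ≠ 0)
    (h : z ^ t * a = c • (x ^ t * b)) : t ≤ 2 * e := by
  have := isDomain h2 hσ0 hσ1
  have hsq : z ^ t * a ^ 2 = star z ^ t * (c ^ 2 • b ^ 2) := by
    apply mul_left_cancel₀ (pow_ne_zero t z_ne_zero)
    have e1 : (x : MarkoffRing σ) ^ t * x ^ t = star z ^ t * z ^ t := by
      rw [← mul_pow, ← mul_pow, star_z_mul_z, sq x]
    rw [Algebra.smul_def] at h ⊢
    rw [map_pow]
    linear_combination (z ^ t * a + algebraMap K _ c * (x ^ t * b)) * h +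
      (algebraMap K (MarkoffRing σ) c) ^ 2 * b ^ 2 * e1
  have hdvd : z ^ t ∣ c ^ 2 • b ^ 2 :=
    ((isCoprime_z_star hσ0).pow (m := t) (n := t)).dvd_of_dvd_mul_left ⟨_, hsq.symm⟩
  obtain ⟨q, hq⟩ := hdvd
  have hb2 : c ^ 2 • b ^ 2 ≠ 0 := smul_ne_zero (pow_ne_zero 2 hc) (pow_ne_zero 2 hb0)
  have hdeg := ((hb.pow 2).smul (c ^ 2)).norm
  have hN : QuadraticAlgebra.norm (c ^ 2 • b ^ 2) ≠ 0 := fun h =>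
    hb2 (eq_zero_of_norm_eq_zero h2 hσ0 hσ1 h)
  have hdv : X ^ (2 * t) ∣ QuadraticAlgebra.norm (c ^ 2 • b ^ 2) := by
    rw [hq, map_mul, map_pow, norm_z, ← pow_mul]
    exact dvd_mul_right _ _
  have := natDegree_le_of_dvd hdv hN
  rw [natDegree_X_pow] at this
  omega

theorem le_of_block_mul_eq (h2 : (2 : K) ≠ 0) (hσ0 : σ ≠ 0) (hσ1 : σ ≠ 1) {a b : MarkoffRing σ}
    {e n m B : ℕ} {c : K} (hb : DegLE e b) (hb0 : b ≠ 0) (hc : c ≠ 0) {i j : Fin B × Fin B}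
    (hij : i.1 = j.1) (hlt : j.2 < i.2)
    (h : block σ n m B i * a = c • (block σ n m B j * b)) : m ≤ 2 * e := by
  have := isDomain h2 hσ0 hσ1
  obtain ⟨i1, ⟨d, hd⟩⟩ := i
  obtain ⟨j1, ⟨d', hd'⟩⟩ := j
  simp only at hij
  subst hij
  simp only [Fin.mk_lt_mk] at hlt
  obtain ⟨k, rfl⟩ := Nat.exists_eq_add_of_lt hlt
  obtain ⟨k', rfl⟩ := Nat.exists_eq_add_of_lt hd
  have hB1 : d' + k + 1 + k' + 1 - (d' + k + 1) = k' + 1 := by omega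
  have hB2 : d' + k + 1 + k' + 1 - d' = (k' + 1) + (k + 1) := by omega
  have hred : z ^ (m * (k + 1)) * a = c • (x ^ (m * (k + 1)) * b) := by
    apply mul_left_cancel₀ (mul_ne_zero (pow_ne_zero (n * i1 + m * (k' + 1)) x_ne_zero)
      (pow_ne_zero (m * d') z_ne_zero))
    simp only [block, hB1, hB2] at h
    rw [Algebra.smul_def] at h ⊢
    linear_combination h
  have := le_of_z_pow_mul_eq h2 hσ0 hσ1 hb hb0 hc hred
  nlinarith

theorem eq_of_block_mul_eq (h2 : (2 : K) ≠ 0) (hσ0 : σ ≠ 0) (hσ1 : σ ≠ 1) {a b : MarkoffRing σ}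
    {e n m B : ℕ} {c : K} (ha : DegLE e a) (ha0 : a ≠ 0) (hb : DegLE e b) (hb0 : b ≠ 0)
    (hn : 2 * e < n) (hm : 2 * e < m) {i j : Fin B × Fin B}
    (h : block σ n m B i * a = c • (block σ n m B j * b)) : i = j := by
  have := isDomain h2 hσ0 hσ1
  have hc : c ≠ 0 := by
    rintro rfl
    rw [zero_smul] at h
    exact mul_ne_zero (block_ne_zero n m B i) ha0 h
  have h' : block σ n m B j * b = c⁻¹ • (block σ n m B i * a) := by
    rw [h, smul_smul, inv_mul_cancel₀ hc, one_smul]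
  have hfst : i.1 = j.1 := by
    have hN := congrArg (fun u => (QuadraticAlgebra.norm u).natDegree) h
    have hNa : QuadraticAlgebra.norm a ≠ 0 := fun h =>
      ha0 (eq_zero_of_norm_eq_zero h2 hσ0 hσ1 h)
    have hNb : QuadraticAlgebra.norm b ≠ 0 := fun h =>
      hb0 (eq_zero_of_norm_eq_zero h2 hσ0 hσ1 h)
    have hXp : ∀ k, (X ^ k : K[X]) ≠ 0 := fun k => pow_ne_zero _ X_ne_zero
    have hcN : QuadraticAlgebra.norm (algebraMap K (MarkoffRing σ) c) = C (c ^ 2) := by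
      rw [IsScalarTower.algebraMap_apply K K[X] (MarkoffRing σ),
        QuadraticAlgebra.norm_algebraMap, C_pow]
      rfl
    simp only [Algebra.smul_def, map_mul, norm_block, hcN] at hN
    rw [natDegree_C_mul (pow_ne_zero 2 hc), natDegree_mul (hXp _) hNa, natDegree_mul (hXp _) hNb,
      natDegree_X_pow, natDegree_X_pow] at hN
    have hda := ha.norm
    have hdb := hb.norm
    by_contra hne
    rcases lt_or_gt_of_ne hne with hlt | hlt
    · have := Nat.mul_le_mul_left n (Nat.succ_le_of_lt (Fin.lt_def.mp hlt))
      rw [Nat.succ_eq_add_one, mul_add] at this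
      omega
    · have := Nat.mul_le_mul_left n (Nat.succ_le_of_lt (Fin.lt_def.mp hlt))
      rw [Nat.succ_eq_add_one, mul_add] at this
      omega
  refine Prod.ext hfst ?_
  by_contra hne
  rcases lt_or_gt_of_ne hne with hlt | hlt
  · have := le_of_block_mul_eq h2 hσ0 hσ1 ha ha0 (inv_ne_zero hc) hfst.symm hlt h'
    omega
  · have := le_of_block_mul_eq h2 hσ0 hσ1 hb hb0 hc hfst hlt h
    omega

end MarkoffRing

section Twisted

variable {k R I : Type*} [CommRing k] [CommRing R] [Algebra k R]

/-- The `s`-th derivative of `P * f`, divided by `f`, when `f` has logarithmic derivative `ω`. -/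
def twistedIterate (E : Derivation k R R) (ω : R) (s : ℕ) : R →ₗ[k] R :=
  ((E : R →ₗ[k] R) + LinearMap.mulLeft k ω) ^ s

theorem twistedIterate_succ (E : Derivation k R R) (ω : R) (s : ℕ) (P : R) :
    twistedIterate E ω (s + 1) P = E (twistedIterate E ω s P) + ω * twistedIterate E ω s P := by
  rw [twistedIterate, pow_succ', Module.End.mul_apply]
  rfl

theorem iterate_mul_eq_twistedIterate_mul {E : Derivation k R R} {f ω : R} (hf : E f = ω * f)
    (P : R) (s : ℕ) : E^[s] (P * f) = twistedIterate E ω s P * f := by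
  induction s with
  | zero => simp [twistedIterate]
  | succ s ih =>
    rw [Function.iterate_succ_apply', ih, twistedIterate_succ, Derivation.leibniz, hf]
    simp only [smul_eq_mul]
    ring

/-- The Wronskian matrix of the `P i * f i`, with each column divided by the corresponding `f i`. -/
def twistedWronskian (E : Derivation k R R) (ω P : I → R) {r : ℕ} (J : Fin r → I) :
    Matrix (Fin r) (Fin r) R :=
  Matrix.of fun s l => twistedIterate E (ω (J l)) s (P (J l))

theorem det_wronskianMatrix_mul {E : Derivation k R R} {f ω : I → R}
    (hf : ∀ i, E (f i) = ω i * f i) (P : I → R) {r : ℕ} (J : Fin r → I) :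
    (wronskianMatrix E (fun i => P i * f i) J).det =
      (∏ l, f (J l)) * (twistedWronskian E ω P J).det := by
  rw [← Matrix.det_mul_row]
  congr 1
  ext s l
  simp only [wronskianMatrix, twistedWronskian, of_apply]
  rw [iterate_mul_eq_twistedIterate_mul (hf (J l)), mul_comm]

theorem mul_deriv_eq_of_mul_left [IsDomain R] {E : Derivation k R R} {Φ a b : R} (hΦ : Φ ≠ 0)
    (h : Φ * a * E (Φ * b) = Φ * b * E (Φ * a)) : a * E b = b * E a := by
  apply mul_left_cancel₀ (mul_ne_zero hΦ hΦ)
  simp only [Derivation.leibniz, smul_eq_mul] at h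
  linear_combination h

/-- A nontrivial relation `∑ i, P i * f i = 0` produces two functions with constant quotient. -/
theorem exists_twistedWronskian_ratio_constant [IsDomain R] [Fintype I] {E : Derivation k R R}
    {f ω P : I → R} (hf : ∀ i, E (f i) = ω i * f i) (hf0 : ∀ i, f i ≠ 0) (hP : ∃ i, P i ≠ 0)
    (hsum : ∑ i, P i * f i = 0) :
    ∃ (r : ℕ) (J J' : Fin r → I) (i j : I), r ≤ Nat.card I ∧ i ≠ j ∧
      (twistedWronskian E ω P J).det ≠ 0 ∧ (twistedWronskian E ω P J').det ≠ 0 ∧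
      (f j * (twistedWronskian E ω P J).det) * E (f i * (twistedWronskian E ω P J').det) =
        (f i * (twistedWronskian E ω P J').det) * E (f j * (twistedWronskian E ω P J).det) := by
  obtain ⟨i₀, hi₀⟩ := hP
  obtain ⟨r, J, l, i, hr, hi, hJ, hJ', hconst⟩ := exists_wronskian_ratio_constant E
    (fun i => P i * f i) ⟨i₀, mul_ne_zero hi₀ (hf0 i₀)⟩ hsum
  have hΦ : ∏ t ∈ Finset.univ.erase l, f (J t) ≠ 0 :=
    Finset.prod_ne_zero_iff.mpr fun t _ => hf0 _
  have hprod : ∏ t, f (J t) = (∏ t ∈ Finset.univ.erase l, f (J t)) * f (J l) :=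
    (Finset.prod_erase_mul _ _ (Finset.mem_univ l)).symm
  have hprod' : ∏ t, f (Function.update J l i t) =
      (∏ t ∈ Finset.univ.erase l, f (J t)) * f i := by
    rw [← Finset.prod_erase_mul _ _ (Finset.mem_univ l), Function.update_self]
    exact congrArg (· * f i) (Finset.prod_congr rfl fun t ht => by
      rw [Function.update_of_ne (Finset.ne_of_mem_erase ht)])
  rw [det_wronskianMatrix_mul hf, hprod, mul_assoc] at hJ hconst
  rw [det_wronskianMatrix_mul hf, hprod', mul_assoc] at hJ' hconst
  exact ⟨r, J, _, i, J l, hr, hi, right_ne_zero_of_mul (right_ne_zero_of_mul hJ),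
    right_ne_zero_of_mul (right_ne_zero_of_mul hJ'), mul_deriv_eq_of_mul_left hΦ
      (by simpa only [mul_assoc] using hconst)⟩

end Twisted

namespace MarkoffRing

variable {K : Type*} [Field K] {σ : K}

theorem DegLE.twistedIterate {A : ℕ} {P : MarkoffRing σ} (hP : DegLE A P) {ω : MarkoffRing σ}
    (hω : DegLE 2 ω) (s : ℕ) : DegLE (A + 2 * s) (twistedIterate (E σ) ω s P) := by
  induction s with
  | zero => simpa [_root_.twistedIterate] using hP
  | succ s ih =>
    rw [twistedIterate_succ]
    exact (ih.deriv.mono (by omega)).add ((hω.mul ih).mono (by omega))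

/-- The logarithmic derivative of `block`. -/
noncomputable def blockLogDeriv (σ : K) (n m B : ℕ) (i : Fin B × Fin B) : MarkoffRing σ :=
  logDeriv σ (n * i.1 + m * (B - i.2)) (m * i.2)

theorem E_block (n m B : ℕ) (i : Fin B × Fin B) :
    E σ (block σ n m B i) = blockLogDeriv σ n m B i * block σ n m B i :=
  E_monomial _ _

variable [IsAlgClosed K]

/-- The functions `block` are linearly independent over functions of small degree. -/
theorem eq_zero_of_sum_mul_block_eq_zero {p : ℕ} [CharP K p] (hp : p.Prime) (h2 : (2 : K) ≠ 0)
    (hσ0 : σ ≠ 0) (hσ1 : σ ≠ 1) {n m B A e : ℕ} (he : B ^ 2 * (A + 2 * B ^ 2) ≤ e)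
    (hn : 2 * e < n) (hm : 2 * e < m) (hlt : 2 * ((n + 2 * m) * B + e) < p)
    {P : Fin B × Fin B → MarkoffRing σ} (hP : ∀ i, DegLE A (P i))
    (hsum : ∑ i, P i * block σ n m B i = 0) (i : Fin B × Fin B) : P i = 0 := by
  have := isDomain h2 hσ0 hσ1
  by_contra hi
  obtain ⟨r, J, J', i', j, hr, hij, hJ, hJ', hconst⟩ :=
    exists_twistedWronskian_ratio_constant (E_block n m B) (block_ne_zero n m B) ⟨i, hi⟩ hsum
  have hr' : r ≤ B ^ 2 := by simpa [sq] using hr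
  have hdet : ∀ J : Fin r → Fin B × Fin B,
      DegLE e (twistedWronskian (E σ) (blockLogDeriv σ n m B) P J).det := by
    intro J
    refine (DegLE.det (d := A + 2 * r) fun s t => ?_).mono
      ((Nat.mul_le_mul hr' (by omega)).trans he)
    exact ((hP _).twistedIterate (DegLE.logDeriv _ _) s).mono (by omega)
  obtain ⟨c, hc⟩ := eq_smul_of_deriv_ratio_eq_zero hp h2 hσ0 hσ1
    ((degLE_block n m B i').mul (hdet J')) ((degLE_block n m B j).mul (hdet J)) hlt
    (mul_ne_zero (block_ne_zero n m B j) hJ) hconst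
  exact hij (eq_of_block_mul_eq h2 hσ0 hσ1 (hdet _) hJ' (hdet _) hJ hn hm hc)

end MarkoffRing

namespace MarkoffRing

variable {K : Type*} [Field K] {σ : K}

/-- Siegel's lemma for the vanishing of twisted derivatives. -/
theorem exists_sum_twistedIterate_eq_zero {ι : Type*} [Fintype ι] {A M : ℕ}
    (hcard : M * (2 * (A + 2 * M)) < Fintype.card ι * A) {ω : ι → MarkoffRing σ}
    (hω : ∀ i, DegLE 2 (ω i)) :
    ∃ P : ι → MarkoffRing σ, (∃ i, P i ≠ 0) ∧ (∀ i, DegLE A (P i)) ∧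
      ∀ k < M, ∑ i, twistedIterate (E σ) (ω i) k (P i) = 0 := by
  set D := A + 2 * M with hD
  let P : (ι → Fin A → K) →ₗ[K] (ι → MarkoffRing σ) := LinearMap.pi fun i =>
    ((Algebra.linearMap K[X] (MarkoffRing σ)).restrictScalars K ∘ₗ (degreeLT K A).subtype) ∘ₗ
      (degreeLTEquiv K A).symm.toLinearMap ∘ₗ LinearMap.proj i
  have hP : ∀ v i, P v i = algebraMap K[X] _ ((degreeLTEquiv K A).symm (v i) : K[X]) :=
    fun v i => rfl
  have hPdeg : ∀ v i, DegLE A (P v i) := by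
    intro v i
    rw [hP]
    have := mem_degreeLT.mp ((degreeLTEquiv K A).symm (v i)).2
    exact ⟨by simpa using natDegree_le_of_degree_le this.le, by simp⟩
  let S : ℕ → (ι → Fin A → K) →ₗ[K] MarkoffRing σ := fun k =>
    ∑ i, twistedIterate (E σ) (ω i) k ∘ₗ LinearMap.proj i ∘ₗ P
  have hS : ∀ k v, S k v = ∑ i, twistedIterate (E σ) (ω i) k (P v i) := fun k v => by
    simp [S, LinearMap.sum_apply]
  let T : (ι → Fin A → K) →ₗ[K] (Fin M → (Fin D → K) × (Fin D → K)) :=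
    { toFun := fun v k => (fun d => (S k v).re.coeff d, fun d => (S k v).im.coeff d)
      map_add' := fun v w => by
        ext <;> simp
      map_smul' := fun c v => by
        ext <;> simp }
  have hker : LinearMap.ker T ≠ ⊥ := by
    apply LinearMap.ker_ne_bot_of_finrank_lt
    simpa [Module.finrank_pi_fintype, Module.finrank_prod, ← two_mul] using hcard
  obtain ⟨v, hv, hv0⟩ := (Submodule.ne_bot_iff _).mp hker
  refine ⟨P v, ?_, hPdeg v, fun k hk => ?_⟩
  · by_contra! h
    apply hv0
    ext1 i
    have hi := h i
    rw [hP, map_eq_zero_iff _ QuadraticAlgebra.algebraMap_injective] at hi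
    simpa using hi
  · rw [← hS]
    have hdeg : DegLE (A + 2 * k) (S k v) := by
      rw [hS]
      exact DegLE.sum _ fun i _ => (hPdeg v i).twistedIterate (hω i) k
    have hk' := congrFun (LinearMap.mem_ker.mp hv) ⟨k, hk⟩
    have hre : ∀ d : Fin D, (S k v).re.coeff d = 0 := congrFun (congrArg Prod.fst hk')
    have him : ∀ d : Fin D, (S k v).im.coeff d = 0 := congrFun (congrArg Prod.snd hk')
    have hzero : ∀ f : K[X], f.natDegree ≤ A + 2 * k → (∀ d : Fin D, f.coeff d = 0) → f = 0 := by
      intro f hf h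
      ext d
      rcases lt_or_ge d D with hd | hd
      · exact h ⟨d, hd⟩
      · exact coeff_eq_zero_of_natDegree_lt (by omega)
    ext1
    · exact hzero _ hdeg.1 hre
    · exact hzero _ ((natDegree_le_X_sq_mul _).trans hdeg.2) him

theorem evalAt_block {n m B : ℕ} {x₀ y₀ : K} {h : (x₀ * y₀) ^ 2 = (x₀ ^ 2 + σ) * (x₀ * y₀) - x₀ ^ 2}
    (hx : x₀ ^ n = 1) (hy : y₀ ^ m = 1) (i : Fin B × Fin B) :
    evalAt x₀ (x₀ * y₀) h (block σ n m B i) = x₀ ^ (m * B) := by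
  rw [block, map_mul, map_pow, map_pow, evalAt_x, evalAt_z, pow_add, pow_mul, hx, one_pow, one_mul,
    mul_pow, pow_mul y₀, hy, one_pow, mul_one, ← pow_add, ← mul_add, Nat.sub_add_cancel i.2.2.le]

variable [IsAlgClosed K]

/-- The auxiliary function of Stepanov's method. -/
theorem exists_auxiliary_function {p : ℕ} [CharP K p] (hp : p.Prime) (h2 : (2 : K) ≠ 0)
    (hσ0 : σ ≠ 0) (hσ1 : σ ≠ 1) {n m b : ℕ} (hb : 0 < b) (hmn : m ≤ n) (hm : 88 * b ^ 4 < m)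
    (hnp : 13 * n * b < p) :
    ∃ Φ : MarkoffRing σ, Φ ≠ 0 ∧ DegLE (7 * n * b) Φ ∧
      ∀ x₀ y₀ (h : (x₀ * y₀) ^ 2 = (x₀ ^ 2 + σ) * (x₀ * y₀) - x₀ ^ 2), x₀ ^ n = 1 → y₀ ^ m = 1 →
        VanishesTo (E σ) (evalAt x₀ (x₀ * y₀) h) (b ^ 2) Φ := by
  have hb1 : 1 ≤ b ^ 4 := Nat.one_le_pow _ _ hb
  obtain ⟨P, ⟨i₀, hi₀⟩, hdeg, hsum⟩ := exists_sum_twistedIterate_eq_zero (A := 3 * b ^ 2)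
    (M := b ^ 2) (ω := blockLogDeriv σ n m (2 * b))
    (by simp only [Fintype.card_prod, Fintype.card_fin]; nlinarith) (fun i => DegLE.logDeriv _ _)
  have hnb : n ≤ n * b := Nat.le_mul_of_pos_right n hb
  have hmb : m * b ≤ n * b := Nat.mul_le_mul_right b hmn
  refine ⟨∑ i, P i * block σ n m (2 * b) i, fun h0 => hi₀ ?_, ?_, ?_⟩
  · refine eq_zero_of_sum_mul_block_eq_zero hp h2 hσ0 hσ1 (e := 44 * b ^ 4) (by nlinarith)
      (by omega) (by omega) ?_ hdeg h0 i₀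
    nlinarith
  · refine DegLE.sum _ fun i _ => ((hdeg i).mul (degLE_block n m _ i)).mono ?_
    have : b ^ 2 ≤ b ^ 4 := Nat.pow_le_pow_right hb (by norm_num)
    nlinarith
  · intro x₀ y₀ h hx hy k hk
    have : (E σ)^[k] (∑ i, P i * block σ n m (2 * b) i) =
        ∑ i, twistedIterate (E σ) (blockLogDeriv σ n m (2 * b) i) k (P i) *
          block σ n m (2 * b) i := by
      rw [iterate_derivation_sum]
      exact Finset.sum_congr rfl fun i _ => iterate_mul_eq_twistedIterate_mul (E_block n m _ i) _ k
    simp only [this, map_sum, map_mul, evalAt_block hx hy]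
    rw [← Finset.sum_mul, ← map_sum, hsum k hk, map_zero, zero_mul]

end MarkoffRing

namespace MarkoffRing

variable {K : Type*} [Field K] {σ : K}

theorem curve_of_eq {x₀ y₀ : K} (hx : x₀ ≠ 0) (hy : y₀ ≠ 0)
    (h : x₀ + σ * x₀⁻¹ = y₀ + y₀⁻¹) :
    (x₀ * y₀) ^ 2 = (x₀ ^ 2 + σ) * (x₀ * y₀) - x₀ ^ 2 := by
  field_simp at h
  linear_combination (-x₀) * h

/-- The function `t + κ / t` takes each value at most twice. -/
theorem card_add_mul_inv_eq_le (S : Finset K) (h0 : ∀ t ∈ S, t ≠ 0) (κ v : K)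
    (h : ∀ t ∈ S, t + κ * t⁻¹ = v) : S.card ≤ 2 := by
  have hne : (X ^ 2 - C v * X + C κ : K[X]) ≠ 0 := by
    intro h0
    have := congrArg (fun f => coeff f 2) h0
    simp at this
  have hdeg : (X ^ 2 - C v * X + C κ : K[X]).natDegree ≤ 2 := by compute_degree
  refine (card_le_degree_of_subset_roots (p := X ^ 2 - C v * X + C κ) fun t ht => ?_).trans hdeg
  rw [mem_roots hne, IsRoot.def]
  have ht0 := h0 t ht
  have := h t ht
  field_simp at this
  simp only [eval_add, eval_sub, eval_pow, eval_X, eval_mul, eval_C]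
  linear_combination this

variable [IsAlgClosed K]

theorem card_mul_le {p : ℕ} [CharP K p] (hp : p.Prime) (h2 : (2 : K) ≠ 0)
    (hσ0 : σ ≠ 0) (hσ1 : σ ≠ 1) {n m b : ℕ} (hb : 0 < b) (hmn : m ≤ n) (hm : 88 * b ^ 4 < m)
    (hnp : 13 * n * b < p) (S : Finset (K × K))
    (hS : ∀ a ∈ S, a.1 ^ n = 1 ∧ a.2 ^ m = 1 ∧ a.1 + σ * a.1⁻¹ = a.2 + a.2⁻¹) :
    S.card * b ≤ 28 * n + 8 * b := by
  classical
  obtain ⟨Φ, hΦ0, hΦdeg, hΦ⟩ := exists_auxiliary_function hp h2 hσ0 hσ1 hb hmn hm hnp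
  have hS0 : ∀ a ∈ S, a.1 ≠ 0 ∧ a.2 ≠ 0 := by
    intro a ha
    obtain ⟨h1, h2, -⟩ := hS a ha
    exact ⟨(IsUnit.of_pow_eq_one h1 (by omega)).ne_zero,
      (IsUnit.of_pow_eq_one h2 (by omega)).ne_zero⟩
  set Q : K[X] := (X ^ 2 + C σ) ^ 2 - 4 * X ^ 2 with hQ
  have hQ0 : Q ≠ 0 := discr_ne_zero h2 hσ0 hσ1
  have hQdeg : Q.natDegree ≤ 4 := by rw [hQ]; compute_degree
  set T := (S.image Prod.fst).filter fun t => Q.eval t ≠ 0 with hT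
  have hTdvd : ∀ t ∈ T, (X - C t) ^ b ^ 2 ∣ QuadraticAlgebra.norm Φ := by
    intro t ht
    simp only [hT, Finset.mem_filter, Finset.mem_image] at ht
    obtain ⟨⟨a, ha, rfl⟩, hQt⟩ := ht
    obtain ⟨h1, h2, h3⟩ := hS a ha
    have hc := curve_of_eq (hS0 a ha).1 (hS0 a ha).2 h3
    have hM : b ^ 2 ≤ p := by
      have : b ^ 2 ≤ b ^ 4 := Nat.pow_le_pow_right hb (by norm_num)
      nlinarith [Nat.le_mul_of_pos_right n hb]
    refine pow_dvd_norm (hS0 a ha).1 (fun h => hQt ?_) hp hM (hΦ a.1 a.2 hc h1 h2)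
    simp only [hQ, eval_sub, eval_pow, eval_add, eval_mul, eval_X, eval_C, eval_ofNat]
    linear_combination (2 * (a.1 * a.2) - (a.1 ^ 2 + σ)) * h - 4 * hc
  have hN0 : QuadraticAlgebra.norm Φ ≠ 0 := fun h =>
    hΦ0 (eq_zero_of_norm_eq_zero h2 hσ0 hσ1 h)
  have hTcard : T.card * b ≤ 14 * n := by
    have hdvd : ∏ t ∈ T, (X - C t) ^ b ^ 2 ∣ QuadraticAlgebra.norm Φ :=
      Finset.prod_dvd_of_coprime
        (fun s _ t _ hst => (isCoprime_X_sub_C_of_isUnit_sub (sub_ne_zero.mpr hst).isUnit).pow)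
        hTdvd
    have := (natDegree_le_of_dvd hdvd hN0).trans hΦdeg.norm
    rw [natDegree_prod _ _ fun t _ => pow_ne_zero _ (X_sub_C_ne_zero t)] at this
    simp only [natDegree_pow, natDegree_X_sub_C, mul_one, Finset.sum_const, smul_eq_mul] at this
    refine Nat.le_of_mul_le_mul_right (c := b) ?_ hb
    linarith
  have himage : (S.image Prod.fst).card ≤ T.card + 4 := by
    rw [← Finset.card_filter_add_card_filter_not (s := S.image Prod.fst) fun t => Q.eval t ≠ 0]
    refine Nat.add_le_add_left ((card_le_degree_of_subset_roots (p := Q) fun t ht => ?_).trans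
      hQdeg) _
    rw [mem_roots hQ0]
    exact not_not.mp (Finset.mem_filter.mp ht).2
  have hfib : S.card ≤ 2 * (S.image Prod.fst).card := by
    refine Finset.card_le_mul_card_image S 2 fun t ht => ?_
    have hinj : Set.InjOn Prod.snd
        ((S.filter fun a => a.1 = t : Finset (K × K)) : Set (K × K)) := by
      intro a ha a' ha' h
      simp only [Finset.coe_filter, Set.mem_ofPred_eq] at ha ha'
      exact Prod.ext (ha.2.trans ha'.2.symm) h
    rw [← Finset.card_image_of_injOn hinj]
    refine card_add_mul_inv_eq_le _ ?_ 1 (t + σ * t⁻¹) ?_ <;>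
      simp only [Finset.mem_image, Finset.mem_filter] <;> rintro _ ⟨a, ⟨ha, rfl⟩, rfl⟩
    · exact (hS0 a ha).2
    · rw [one_mul, (hS a ha).2.2]
  nlinarith

end MarkoffRing

section Count

variable {F : Type*} [Field F] [Finite F]

/-- The solutions of `h₁ + σ / h₁ = h₂ + 1 / h₂` with `h₁ ∈ H₁` and `h₂ ∈ H₂`. -/
def markoffPairs (σ : F) (H₁ H₂ : Subgroup Fˣ) : Set (Fˣ × Fˣ) :=
  {hh | hh.1 ∈ H₁ ∧ hh.2 ∈ H₂ ∧
    (hh.1 : F) + σ * ((hh.1⁻¹ : Fˣ) : F) = (hh.2 : F) + ((hh.2⁻¹ : Fˣ) : F)}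

theorem ncard_markoffPairs_le (σ : F) (H₁ H₂ : Subgroup Fˣ) :
    (markoffPairs σ H₁ H₂).ncard ≤ 2 * Nat.card H₂ := by
  classical
  have := Fintype.ofFinite F
  rw [Set.ncard_eq_toFinset_card']
  set S := (markoffPairs σ H₁ H₂).toFinset with hS
  have hmem : ∀ a ∈ S, a ∈ markoffPairs σ H₁ H₂ := fun a ha => Set.mem_toFinset.mp ha
  have himage : (S.image Prod.snd).card ≤ Nat.card H₂ := by
    rw [← SetLike.coe_sort_coe, Nat.card_coe_set_eq, ← Set.ncard_coe_finset]
    refine Set.ncard_le_ncard (fun h hh => ?_) (Set.toFinite _)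
    obtain ⟨a, ha, rfl⟩ := Finset.mem_image.mp (Finset.mem_coe.mp hh)
    exact (hmem a ha).2.1
  refine (Finset.card_le_mul_card_image (f := Prod.snd) S 2 fun t ht => ?_).trans
    (Nat.mul_le_mul_left 2 himage)
  have hinj : Set.InjOn (fun a : Fˣ × Fˣ => (a.1 : F))
      ((S.filter fun a => a.2 = t : Finset (Fˣ × Fˣ)) : Set (Fˣ × Fˣ)) := by
    intro a ha a' ha' h
    simp only [Finset.coe_filter, Set.mem_ofPred_eq] at ha ha'
    exact Prod.ext (Units.ext h) (ha.2.trans ha'.2.symm)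
  rw [← Finset.card_image_of_injOn hinj]
  refine MarkoffRing.card_add_mul_inv_eq_le _ ?_ σ ((t : F) + ((t⁻¹ : Fˣ) : F)) ?_ <;>
    simp only [Finset.mem_image, Finset.mem_filter] <;> rintro _ ⟨a, ⟨ha, rfl⟩, rfl⟩
  · exact a.1.ne_zero
  · rw [← (hmem a ha).2.2, Units.val_inv_eq_inv_val]

theorem ncard_markoffPairs_mul_le {p : ℕ} [CharP F p] (hp : p.Prime) (h2 : (2 : F) ≠ 0) {σ : F}
    (hσ0 : σ ≠ 0) (hσ1 : σ ≠ 1) (H₁ H₂ : Subgroup Fˣ) {b : ℕ} (hb : 0 < b)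
    (hle : Nat.card H₂ ≤ Nat.card H₁) (hm : 88 * b ^ 4 < Nat.card H₂)
    (hnp : 13 * Nat.card H₁ * b < p) :
    (markoffPairs σ H₁ H₂).ncard * b ≤ 28 * Nat.card H₁ + 8 * b := by
  classical
  have := Fintype.ofFinite F
  let φ := algebraMap F (AlgebraicClosure F)
  have hφ : Function.Injective φ := φ.injective
  have : CharP (AlgebraicClosure F) p := charP_of_injective_algebraMap hφ p
  have hinj : Function.Injective fun a : Fˣ × Fˣ => (φ a.1, φ a.2) := by
    intro a a' h
    simp only [Prod.mk.injEq] at h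
    exact Prod.ext (Units.ext (hφ h.1)) (Units.ext (hφ h.2))
  have hpow : ∀ (H : Subgroup Fˣ), ∀ h ∈ H, φ h ^ Nat.card H = 1 := by
    intro H h hh
    rw [← map_pow, ← Units.val_pow_eq_pow_val]
    have := congrArg Subtype.val (pow_card_eq_one' (x := (⟨h, hh⟩ : H)))
    simp only [SubmonoidClass.mk_pow, OneMemClass.coe_one] at this
    rw [this, Units.val_one, map_one]
  rw [Set.ncard_eq_toFinset_card', ← Finset.card_image_of_injective _ hinj]
  refine MarkoffRing.card_mul_le (σ := φ σ) hp ?_ ?_ ?_ hb hle hm hnp _ ?_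
  · rw [← map_ofNat φ]
    exact (map_ne_zero_iff φ hφ).mpr h2
  · exact (map_ne_zero_iff φ hφ).mpr hσ0
  · rwa [← map_one φ, Ne, hφ.eq_iff]
  · simp only [Finset.mem_image, Set.mem_toFinset]
    rintro _ ⟨a, ⟨h1, h2, h3⟩, rfl⟩
    refine ⟨hpow _ _ h1, hpow _ _ h2, ?_⟩
    simpa using congrArg φ h3

end Count

theorem exists_nat_between_of_rpow {δ ε : ℝ} (hε : 0 < ε) (hε8 : 8 * ε ≤ 1) (hεδ : 8 * ε ≤ δ)
    {n p : ℕ} (hp : 0 < p) (hnε : 100 ≤ (n : ℝ) ^ ε) (hnp : (n : ℝ) < (p : ℝ) ^ (1 - δ)) :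
    ∃ b : ℕ, 0 < b ∧ (n : ℝ) ^ ε ≤ 2 * b ∧ 88 * (b : ℝ) ^ 4 ≤ (n : ℝ) ^ (1 - ε) ∧
      13 * n * b < p := by
  have hn1 : (1 : ℝ) ≤ n := by
    by_contra! h
    have := Real.rpow_le_one (Nat.cast_nonneg n) h.le hε.le
    linarith
  have hn0 : (0 : ℝ) < n := by linarith
  set t := (n : ℝ) ^ ε with ht
  have hbt : (⌊t⌋₊ : ℝ) ≤ t := Nat.floor_le (by linarith)
  have hbt' : t < ⌊t⌋₊ + 1 := Nat.lt_floor_add_one t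
  refine ⟨⌊t⌋₊, Nat.floor_pos.mpr (by linarith), by linarith, ?_, ?_⟩
  · have h5 : t ^ 5 ≤ (n : ℝ) ^ (1 - ε) := by
      rw [ht, ← Real.rpow_natCast, ← Real.rpow_mul hn0.le]
      exact Real.rpow_le_rpow_of_exponent_le hn1 (by push_cast; linarith)
    have h4 : (⌊t⌋₊ : ℝ) ^ 4 ≤ t ^ 4 := pow_le_pow_left₀ (Nat.cast_nonneg _) hbt 4
    have h4' : 0 ≤ t ^ 4 := by positivity
    nlinarith
  · have hnδ : (n : ℝ) ^ (1 + δ) ≤ p := by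
      have hp1 : (1 : ℝ) ≤ p := by exact_mod_cast hp
      calc (n : ℝ) ^ (1 + δ) ≤ ((p : ℝ) ^ (1 - δ)) ^ (1 + δ) :=
            Real.rpow_le_rpow hn0.le hnp.le (by linarith)
        _ = (p : ℝ) ^ ((1 - δ) * (1 + δ)) := (Real.rpow_mul (by linarith) _ _).symm
        _ ≤ (p : ℝ) ^ (1 : ℝ) := Real.rpow_le_rpow_of_exponent_le hp1 (by nlinarith)
        _ = p := Real.rpow_one _
    have ht2 : (n : ℝ) * t ^ 2 ≤ (n : ℝ) ^ (1 + δ) := by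
      rw [ht, ← Real.rpow_natCast, ← Real.rpow_mul hn0.le]
      nth_rw 1 [← Real.rpow_one (n : ℝ)]
      rw [← Real.rpow_add hn0]
      exact Real.rpow_le_rpow_of_exponent_le hn1 (by push_cast; linarith)
    have h1 : (n : ℝ) * ⌊t⌋₊ ≤ n * t := mul_le_mul_of_nonneg_left hbt hn0.le
    have h2 : 0 < (n : ℝ) * t := by positivity
    have : (13 * n * ⌊t⌋₊ : ℝ) < p := by nlinarith
    exact_mod_cast this

end Helpers

theorem markoff_middle_game_count (δ : ℝ) (hδ : 0 < δ) :
    ∃ τ : ℝ, τ < 1 ∧ ∃ C : ℝ, 0 < C ∧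
      ∀ p : ℕ, p.Prime →
        ∀ (F : Type) [Field F] [Algebra (ZMod p) F], Nat.card F = p ^ 2 →
          ∀ σ : ZMod p, σ ≠ 0 → σ ≠ 1 →
            ∀ H₁ H₂ : Subgroup Fˣ,
              ((∀ h ∈ H₁, ∃ a : ZMod p, (h : F) = algebraMap (ZMod p) F a) ∨
                (∀ h ∈ H₁, (h : F) ^ (p + 1) = 1)) →
              ((∀ h ∈ H₂, ∃ a : ZMod p, (h : F) = algebraMap (ZMod p) F a) ∨
                (∀ h ∈ H₂, (h : F) ^ (p + 1) = 1)) →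
              Nat.card H₂ ≤ Nat.card H₁ →
              (p : ℝ) ^ δ < (Nat.card H₁ : ℝ) →
              (Nat.card H₁ : ℝ) < (p : ℝ) ^ (1 - δ) →
              ({hh : Fˣ × Fˣ | hh.1 ∈ H₁ ∧ hh.2 ∈ H₂ ∧
                  (hh.1 : F) + algebraMap (ZMod p) F σ * ((hh.1⁻¹ : Fˣ) : F) =
                    (hh.2 : F) + ((hh.2⁻¹ : Fˣ) : F)}.ncard : ℝ) ≤
                C * (Nat.card H₁ : ℝ) ^ τ := by
  set ε := min δ 1 / 8 with hε
  have hε0 : 0 < ε := div_pos (lt_min hδ one_pos) (by norm_num)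
  have hεδ : 8 * ε ≤ δ := by linarith [min_le_left δ 1]
  have hε1 : 8 * ε ≤ 1 := by linarith [min_le_right δ 1]
  refine ⟨1 - ε, by linarith, 200, by norm_num, ?_⟩
  intro p hp F _ _ hF σ hσ0 hσ1 H₁ H₂ _ _ hle _ hnp
  have := Fact.mk hp
  have : Finite F := Nat.finite_of_card_ne_zero (by rw [hF]; exact pow_ne_zero 2 hp.ne_zero)
  have hinj : Function.Injective (algebraMap (ZMod p) F) := (algebraMap (ZMod p) F).injective
  have : CharP F p := charP_of_injective_algebraMap hinj p
  change ((markoffPairs (algebraMap (ZMod p) F σ) H₁ H₂).ncard : ℝ) ≤ _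
  set N := (markoffPairs (algebraMap (ZMod p) F σ) H₁ H₂).ncard
  have htriv : (N : ℝ) ≤ 2 * Nat.card H₂ := by exact_mod_cast ncard_markoffPairs_le _ H₁ H₂
  have hle' : (Nat.card H₂ : ℝ) ≤ Nat.card H₁ := by exact_mod_cast hle
  have hn1 : (1 : ℝ) ≤ Nat.card H₁ := by exact_mod_cast Nat.card_pos (α := H₁)
  have hn0 : (0 : ℝ) < Nat.card H₁ := by linarith
  have hsplit : (Nat.card H₁ : ℝ) ^ (1 - ε) * (Nat.card H₁ : ℝ) ^ ε = Nat.card H₁ := by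
    rw [← Real.rpow_add hn0, sub_add_cancel, Real.rpow_one]
  have hτ1 : 1 ≤ (Nat.card H₁ : ℝ) ^ (1 - ε) := Real.one_le_rpow hn1 (by linarith)
  rcases lt_or_ge ((Nat.card H₁ : ℝ) ^ ε) 100 with hsmall | hlarge
  · nlinarith
  rcases le_or_gt (Nat.card H₂ : ℝ) ((Nat.card H₁ : ℝ) ^ (1 - ε)) with hm | hm
  · linarith
  obtain ⟨b, hb0, hb, hb4, hbp⟩ := exists_nat_between_of_rpow hε0 hε1 hεδ hp.pos hlarge hnp
  have h2 : (2 : F) ≠ 0 := by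
    have hp2 : ¬ p ∣ 2 := fun h => by
      have := Nat.le_of_dvd two_pos h
      nlinarith [Nat.card_pos (α := H₁), Nat.mul_pos (Nat.card_pos (α := H₁)) hb0]
    exact_mod_cast fun h => hp2 ((CharP.cast_eq_zero_iff F p 2).mp h)
  have hmain := ncard_markoffPairs_mul_le hp h2 ((map_ne_zero_iff _ hinj).mpr hσ0)
    (fun h => hσ1 (hinj (h.trans (map_one _).symm))) H₁ H₂ hb0 hle
    (by exact_mod_cast hb4.trans_lt hm) hbp
  have hmain' : (N : ℝ) * b ≤ 28 * Nat.card H₁ + 8 * b := by exact_mod_cast hmain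
  have hb0' : (0 : ℝ) < b := by exact_mod_cast hb0
  refine le_of_mul_le_mul_right (hmain'.trans ?_) hb0'
  nlinarith [mul_le_mul_of_nonneg_left hb (zero_le_one.trans hτ1)]
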